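/- arXiv:1601.01626 — 4 statements merged into one kernel-verified Lean document; each statement's English description precedes it below -/
import Mathlib

section
/- Let U₁, U₂, U₃, U₄ : ℝ² → ℝ be differentiable at a point (x,y) and let Φ(x·e1+y·e2) = U₁·e1 + U₂·i·e1 + U₃·e2 + U₄·i·e2 be the associated 𝔹-valued function on the plane μ. Then the 𝔹-valued identity ∂Φ/∂y · e1 = ∂Φ/∂x · e2 holds at this point if and only if the four real equations hold there: ∂U₁/∂y = ∂U₃/∂x; ∂U₂/∂y = ∂U₄/∂x; ∂U₃/∂y = ∂U₁/∂x − 2·∂U₄/∂x; ∂U₄/∂y = ∂U₂/∂x + 2·∂U₃/∂x. -/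
/- 𝔹 = dual numbers over ℂ, e1 = 1, e2 = i + ε.  The 𝔹-valued identity
   ∂Φ/∂y · e1 = ∂Φ/∂x · e2 (partial derivatives taken componentwise) is
   equivalent to the four real Cauchy–Riemann-type equations. -/

open TrivSqZeroExt DualNumber

noncomputable section

/-- The basis element `e₂ = i + ε` of the biharmonic algebra `𝔹 = ℂ[ε]`. -/
def e₂ : DualNumber ℂ := inl Complex.I + eps

/-- The element `a·e1 + b·i·e1 + c·e2 + d·i·e2` of `𝔹`. -/
def rep (a b c d : ℝ) : DualNumber ℂ :=
  inl (a : ℂ) * 1 + inl (b : ℂ) * inl Complex.I * 1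
    + inl (c : ℂ) * e₂ + inl (d : ℂ) * inl Complex.I * e₂

/-- The partial derivative in `x` of a function `ℝ² → ℝ`. -/
def pdx (f : ℝ × ℝ → ℝ) : ℝ × ℝ → ℝ := fun p => fderiv ℝ f p (1, 0)

/-- The partial derivative in `y` of a function `ℝ² → ℝ`. -/
def pdy (f : ℝ × ℝ → ℝ) : ℝ × ℝ → ℝ := fun p => fderiv ℝ f p (0, 1)

theorem fst_e₂ : e₂.fst = Complex.I := by simp [e₂]

theorem snd_e₂ : e₂.snd = 1 := by simp [e₂]

theorem fst_rep (a b c d : ℝ) :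
    (rep a b c d).fst = a + b * Complex.I + c * Complex.I - d := by
  simp only [rep, fst_add, fst_mul, fst_inl, fst_one, fst_e₂]
  linear_combination (d : ℂ) * Complex.I_mul_I

theorem snd_rep (a b c d : ℝ) : (rep a b c d).snd = c + d * Complex.I := by
  simp [rep, snd_e₂]

/-- `1, i, e₂, i·e₂` are linearly independent over `ℝ`. -/
theorem rep_inj {a b c d a' b' c' d' : ℝ} :
    rep a b c d = rep a' b' c' d' ↔ a = a' ∧ b = b' ∧ c = c' ∧ d = d' := by
  refine ⟨fun h => ?_, by rintro ⟨rfl, rfl, rfl, rfl⟩; rfl⟩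
  have h₁ := congrArg TrivSqZeroExt.fst h
  have h₂ := congrArg TrivSqZeroExt.snd h
  simp only [fst_rep, snd_rep, Complex.ext_iff] at h₁ h₂
  simp at h₁ h₂
  grind

/-- Multiplication by `e₂` in coordinates, a consequence of `e₂² = 1 + 2i·e₂`. -/
theorem rep_mul_e₂ (a b c d : ℝ) :
    rep a b c d * e₂ = rep c d (a - 2 * d) (b + 2 * c) := by
  ext
  · simp only [fst_mul, fst_rep, fst_e₂]
    push_cast
    linear_combination ((b : ℂ) + c) * Complex.I_mul_I
  · simp only [DualNumber.snd_mul, fst_rep, snd_rep, fst_e₂, snd_e₂]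
    push_cast
    linear_combination (d : ℂ) * Complex.I_mul_I

/-- For differentiable components `U₁, U₂, U₃, U₄` at a point `p`, the 𝔹-valued
identity `∂Φ/∂y · e1 = ∂Φ/∂x · e2` (with `Φ = U₁e1 + U₂ie1 + U₃e2 + U₄ie2` and
componentwise partial derivatives) holds at `p` if and only if the four real
Cauchy–Riemann-type equations hold at `p`. -/
theorem CR_condition_iff (U₁ U₂ U₃ U₄ : ℝ × ℝ → ℝ) (p : ℝ × ℝ)
    (h₁ : DifferentiableAt ℝ U₁ p) (h₂ : DifferentiableAt ℝ U₂ p)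
    (h₃ : DifferentiableAt ℝ U₃ p) (h₄ : DifferentiableAt ℝ U₄ p) :
    (rep (pdy U₁ p) (pdy U₂ p) (pdy U₃ p) (pdy U₄ p) * 1
        = rep (pdx U₁ p) (pdx U₂ p) (pdx U₃ p) (pdx U₄ p) * e₂) ↔
      (pdy U₁ p = pdx U₃ p ∧
       pdy U₂ p = pdx U₄ p ∧
       pdy U₃ p = pdx U₁ p - 2 * pdx U₄ p ∧
       pdy U₄ p = pdx U₂ p + 2 * pdx U₃ p) := by
  rw [mul_one, rep_mul_e₂, rep_inj]
end
end

section
/- Laplacian relations for components of a monogenic function: let D ⊆ ℝ² be open and let U₁, U₂, U₃, U₄ : D → ℝ be twice continuously differentiable and satisfy the Cauchy–Riemann-type system (CR) on D. Then at every point of D: Δ U₁ = Δ U₄ = 2(∂²U₁/∂x² − ∂²U₄/∂x²) and Δ U₂ = −Δ U₃ = 2(∂²U₂/∂x² + ∂²U₃/∂x²), where Δ = ∂²/∂x² + ∂²/∂y² is the two-dimensional Laplacian. -/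
/- Laplacian relations for the components of a monogenic function. -/

noncomputable section

/-- The two-dimensional Laplacian `Δf = f_xx + f_yy` at a point. -/
def lap (f : ℝ × ℝ → ℝ) (p : ℝ × ℝ) : ℝ := pdx (pdx f) p + pdy (pdy f) p

/-- The Cauchy–Riemann-type system for the components `U₁, U₂, U₃, U₄`. -/
def CRsys (U₁ U₂ U₃ U₄ : ℝ × ℝ → ℝ) (p : ℝ × ℝ) : Prop :=
  pdy U₁ p = pdx U₃ p ∧
  pdy U₂ p = pdx U₄ p ∧
  pdy U₃ p = pdx U₁ p - 2 * pdx U₄ p ∧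
  pdy U₄ p = pdx U₂ p + 2 * pdx U₃ p

theorem pdx_congr {f g : ℝ × ℝ → ℝ} {p : ℝ × ℝ} (h : f =ᶠ[nhds p] g) : pdx f p = pdx g p := by
  simp only [pdx, h.fderiv_eq]

theorem pdy_congr {f g : ℝ × ℝ → ℝ} {p : ℝ × ℝ} (h : f =ᶠ[nhds p] g) : pdy f p = pdy g p := by
  simp only [pdy, h.fderiv_eq]

theorem pdx_add_const_mul {f g : ℝ × ℝ → ℝ} {p : ℝ × ℝ} (hf : DifferentiableAt ℝ f p)
    (hg : DifferentiableAt ℝ g p) (c : ℝ) :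
    pdx (fun q => f q + c * g q) p = pdx f p + c * pdx g p := by
  simp [pdx, fderiv_fun_add hf (hg.const_mul c), fderiv_const_mul hg]

theorem pdy_add_const_mul {f g : ℝ × ℝ → ℝ} {p : ℝ × ℝ} (hf : DifferentiableAt ℝ f p)
    (hg : DifferentiableAt ℝ g p) (c : ℝ) :
    pdy (fun q => f q + c * g q) p = pdy f p + c * pdy g p := by
  simp [pdy, fderiv_fun_add hf (hg.const_mul c), fderiv_const_mul hg]

theorem ContDiffAt.differentiableAt_fderiv_of_two {f : ℝ × ℝ → ℝ} {p : ℝ × ℝ}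
    (hf : ContDiffAt ℝ 2 f p) : DifferentiableAt ℝ (fderiv ℝ f) p :=
  (hf.fderiv_right (m := 1) (by norm_num)).differentiableAt one_ne_zero

theorem ContDiffAt.differentiableAt_pdx {f : ℝ × ℝ → ℝ} {p : ℝ × ℝ}
    (hf : ContDiffAt ℝ 2 f p) : DifferentiableAt ℝ (pdx f) p :=
  hf.differentiableAt_fderiv_of_two.clm_apply (differentiableAt_const _)

/-- Symmetry of the mixed second partial derivatives. -/
theorem ContDiffAt.pdy_pdx {f : ℝ × ℝ → ℝ} {p : ℝ × ℝ} (hf : ContDiffAt ℝ 2 f p) :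
    pdy (pdx f) p = pdx (pdy f) p := by
  have key (v w : ℝ × ℝ) :
      fderiv ℝ (fun q => fderiv ℝ f q v) p w = fderiv ℝ (fderiv ℝ f) p w v := by
    rw [fderiv_clm_apply hf.differentiableAt_fderiv_of_two (differentiableAt_const v)]
    simp
  exact (key _ _).trans (((hf.isSymmSndFDerivAt (by simp)).eq _ _).trans (key _ _).symm)

/-- Laplacian relations for components of a monogenic function: if `U₁, U₂, U₃, U₄`
are twice continuously differentiable on an open set `D` and satisfy (CR) there, then
at every point of `D`:
`ΔU₁ = ΔU₄ = 2(U₁ₓₓ − U₄ₓₓ)` and `ΔU₂ = −ΔU₃ = 2(U₂ₓₓ + U₃ₓₓ)`. -/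
theorem laplacian_relations (D : Set (ℝ × ℝ)) (hD : IsOpen D)
    (U₁ U₂ U₃ U₄ : ℝ × ℝ → ℝ)
    (h₁ : ContDiffOn ℝ 2 U₁ D) (h₂ : ContDiffOn ℝ 2 U₂ D)
    (h₃ : ContDiffOn ℝ 2 U₃ D) (h₄ : ContDiffOn ℝ 2 U₄ D)
    (hCR : ∀ p ∈ D, CRsys U₁ U₂ U₃ U₄ p) :
    ∀ p ∈ D,
      lap U₁ p = 2 * (pdx (pdx U₁) p - pdx (pdx U₄) p) ∧
      lap U₄ p = 2 * (pdx (pdx U₁) p - pdx (pdx U₄) p) ∧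
      lap U₂ p = 2 * (pdx (pdx U₂) p + pdx (pdx U₃) p) ∧
      -lap U₃ p = 2 * (pdx (pdx U₂) p + pdx (pdx U₃) p) := by
  intro p hp
  have hDp : D ∈ nhds p := hD.mem_nhds hp
  have c₁ := h₁.contDiffAt hDp
  have c₂ := h₂.contDiffAt hDp
  have c₃ := h₃.contDiffAt hDp
  have c₄ := h₄.contDiffAt hDp
  have e₁ : pdy U₁ =ᶠ[nhds p] pdx U₃ := by
    filter_upwards [hDp] with q hq using (hCR q hq).1
  have e₂ : pdy U₂ =ᶠ[nhds p] pdx U₄ := by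
    filter_upwards [hDp] with q hq using (hCR q hq).2.1
  have e₃ : pdy U₃ =ᶠ[nhds p] fun q => pdx U₁ q + (-2) * pdx U₄ q := by
    filter_upwards [hDp] with q hq
    rw [(hCR q hq).2.2.1]
    ring
  have e₄ : pdy U₄ =ᶠ[nhds p] fun q => pdx U₂ q + 2 * pdx U₃ q := by
    filter_upwards [hDp] with q hq using (hCR q hq).2.2.2
  have x₁ := pdx_congr e₁
  have x₂ := pdx_congr e₂
  have x₃ := pdx_congr e₃
  have x₄ := pdx_congr e₄
  have y₁ := pdy_congr e₁
  have y₂ := pdy_congr e₂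
  have y₃ := pdy_congr e₃
  have y₄ := pdy_congr e₄
  rw [pdx_add_const_mul c₁.differentiableAt_pdx c₄.differentiableAt_pdx] at x₃
  rw [pdx_add_const_mul c₂.differentiableAt_pdx c₃.differentiableAt_pdx] at x₄
  rw [pdy_add_const_mul c₁.differentiableAt_pdx c₄.differentiableAt_pdx, c₁.pdy_pdx,
    c₄.pdy_pdx] at y₃
  rw [pdy_add_const_mul c₂.differentiableAt_pdx c₃.differentiableAt_pdx, c₂.pdy_pdx,
    c₃.pdy_pdx] at y₄
  rw [c₃.pdy_pdx] at y₁
  rw [c₄.pdy_pdx] at y₂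
  simp only [lap]
  refine ⟨?_, ?_, ?_, ?_⟩ <;> linarith
end
end

section
/- Every biharmonic function is the first component of a monogenic function: let D ⊆ ℝ² be a bounded simply connected open set and let W : D → ℝ be four times continuously differentiable with ∂⁴W/∂x⁴ + 2·∂⁴W/∂x²∂y² + ∂⁴W/∂y⁴ = 0 in D. Then there exist differentiable functions U₂, U₃, U₄ : D → ℝ such that the quadruple (W, U₂, U₃, U₄) satisfies the Cauchy–Riemann-type system (CR) on D, i.e. W = U₁ is the first component of a monogenic 𝔹-valued function on D_ζ. -/
/- Every biharmonic function on a bounded simply connected domain is the first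
   component of a monogenic 𝔹-valued function. -/

noncomputable section

open Topology Set

/-- Functions on an open cover of a simply connected space whose pairwise differences are locally
constant glue, up to locally constant summands, to a global function. -/
theorem exists_sub_locally_const {X A : Type*} [TopologicalSpace X] [SimplyConnectedSpace X]
    [LocallyPathConnectedSpace X] [AddCommGroup A] (U : X → Set X) (hU : ∀ i, IsOpen (U i))
    (hmem : ∀ i, i ∈ U i) (f : X → X → A)
    (hf : ∀ i j, ∀ x ∈ U i ∩ U j, ∀ᶠ y in 𝓝 x, f i y - f j y = f i x - f j x) :
    ∃ F : X → A, ∀ i, ∀ x ∈ U i, ∀ᶠ y in 𝓝 x, F y - f i y = F x - f i x := by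
  let _ : TopologicalSpace A := ⊥
  have : DiscreteTopology A := ⟨rfl⟩
  let Z : FiberBundleCore X X A :=
    { baseSet := U
      isOpen_baseSet := hU
      indexAt := id
      mem_baseSet_at := hmem
      coordChange := fun i j x v => v + (f i x - f j x)
      coordChange_self := fun i x _ v => by simp
      continuousOn_coordChange := fun i j => by
        have h : ContinuousOn (fun x => f i x - f j x) (U i ∩ U j) := fun x hx =>
          (continuousAt_const.congr (by
            filter_upwards [hf i j x hx] with y hy using hy.symm)).continuousWithinAt
        exact continuous_snd.continuousOn.add
          (h.comp continuous_fst.continuousOn fun p hp => hp.1)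
      coordChange_comp := fun i j k x _ v => by abel }
  have hcov : IsCoveringMap Z.proj :=
    IsCoveringMap.mk _ (fun _ => A) (fun x => Z.localTriv x) hmem
  obtain ⟨x₀⟩ : Nonempty X := inferInstance
  obtain ⟨G, ⟨-, hG⟩, -⟩ := hcov.existsUnique_continuousMap_lifts (ContinuousMap.id X) x₀
    (⟨x₀, (0 : A)⟩ : Z.TotalSpace) rfl
  have hGx : ∀ x, Z.proj (G x) = x := congrFun hG
  refine ⟨fun x => (Z.localTriv x (G x)).2 + f x x, fun i x hx => ?_⟩
  have key : ∀ y ∈ U i, (Z.localTriv y (G y)).2 + f y y - f i y = (Z.localTriv i (G y)).2 := by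
    intro y hy
    have h1 := hGx y
    have : ∀ j, (Z.localTriv j (G y)).2 = Z.coordChange y j y (G y).2 := by
      intro j
      change Z.coordChange (Z.proj (G y)) j (Z.proj (G y)) (G y).2 = _
      rw [h1]
    rw [this, this]
    simp only [Z]
    abel
  have hc : ContinuousAt (fun y => (Z.localTriv i (G y)).2) x := by
    refine continuousAt_snd.comp (ContinuousAt.comp ?_ G.continuous.continuousAt)
    refine (Z.localTriv i).continuousAt ?_
    rw [(Z.localTriv i).mem_source]
    change Z.proj (G x) ∈ U i
    rwa [hGx]
  have := hc.eventually (f := fun y => (Z.localTriv i (G y)).2)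
    (p := fun a => a = (Z.localTriv i (G x)).2) (by rw [nhds_discrete]; simp)
  filter_upwards [this, (hU i).mem_nhds hx] with y hy hyU
  rw [key y hyU, key x hx, hy]

/-- **Poincaré lemma** for `1`-forms on simply connected open sets. -/
theorem IsSimplyConnected.exists_forall_hasFDerivAt_of_fderiv_symmetric
    {E F : Type*} [NormedAddCommGroup E] [NormedSpace ℝ E] [NormedAddCommGroup F]
    [NormedSpace ℝ F] [CompleteSpace F] {s : Set E} (hs : IsSimplyConnected s) (hso : IsOpen s)
    {ω : E → E →L[ℝ] F} (hω : DifferentiableOn ℝ ω s)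
    (hdω : ∀ a ∈ s, ∀ x y, fderiv ℝ ω a x y = fderiv ℝ ω a y x) :
    ∃ f, ∀ a ∈ s, HasFDerivAt f (ω a) a := by
  have := hs.simplyConnectedSpace
  have := hso.locallyPathConnectedSpace
  choose r hr hrs using fun x : s => Metric.isOpen_iff.mp hso x x.2
  have hloc : ∀ x : s, ∃ f, ∀ a ∈ Metric.ball (x : E) (r x), HasFDerivAt f (ω a) a := fun x =>
    (convex_ball _ _).exists_forall_hasFDerivAt_of_fderiv_symmetric Metric.isOpen_ball
      (hω.mono (hrs x)) fun a ha => hdω a (hrs x ha)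
  choose g hg using hloc
  obtain ⟨f, hf⟩ := exists_sub_locally_const (fun x : s => Subtype.val ⁻¹' Metric.ball (x : E) (r x))
    (fun x => Metric.isOpen_ball.preimage continuous_subtype_val)
    (fun x => Metric.mem_ball_self (hr x)) (fun x y => g x y) (by
      rintro i j x ⟨hi, hj⟩
      obtain ⟨ε, hε, hsub⟩ := Metric.isOpen_iff.mp
        ((Metric.isOpen_ball (x := (i : E)) (ε := r i)).inter
          (Metric.isOpen_ball (x := (j : E)) (ε := r j))) x ⟨hi, hj⟩
      have hd : ∀ y ∈ Metric.ball (x : E) ε, HasFDerivAt (fun z => g i z - g j z) (0 : E →L[ℝ] F) y :=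
        fun y hy => by
          simpa using (hg i y (hsub hy).1).fun_sub (hg j y (hsub hy).2)
      filter_upwards [continuousAt_subtype_val.eventually (Metric.ball_mem_nhds (x : E) hε)]
        with y hy
      exact (convex_ball (x : E) ε).is_const_of_fderivWithin_eq_zero (𝕜 := ℝ)
        (fun z hz => (hd z hz).differentiableAt.differentiableWithinAt)
        (fun z hz => (hd z hz).hasFDerivWithinAt.fderivWithin
          (Metric.isOpen_ball.uniqueDiffWithinAt hz)) hy (Metric.mem_ball_self hε))
  classical
  refine ⟨fun x => if hx : x ∈ s then f ⟨x, hx⟩ else 0, fun a ha => ?_⟩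
  have h := hf ⟨a, ha⟩ ⟨a, ha⟩ (Metric.mem_ball_self (hr _))
  rw [nhds_subtype_eq_comap, Filter.eventually_comap] at h
  refine ((hg ⟨a, ha⟩ a (Metric.mem_ball_self (hr _))).add_const
    (f ⟨a, ha⟩ - g ⟨a, ha⟩ a)).congr_of_eventuallyEq ?_
  filter_upwards [h, hso.mem_nhds ha] with y hy hys
  have := hy ⟨y, hys⟩ rfl
  simp only [dif_pos hys]
  rw [← this]
  abel

theorem ContDiffOn.pdx {D : Set (ℝ × ℝ)} (hD : IsOpen D) {f : ℝ × ℝ → ℝ} {m n : WithTop ℕ∞}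
    (hf : ContDiffOn ℝ n f D) (hmn : m + 1 ≤ n) : ContDiffOn ℝ m (pdx f) D :=
  (hf.fderiv_of_isOpen hD hmn).clm_apply contDiffOn_const

theorem ContDiffOn.pdy {D : Set (ℝ × ℝ)} (hD : IsOpen D) {f : ℝ × ℝ → ℝ} {m n : WithTop ℕ∞}
    (hf : ContDiffOn ℝ n f D) (hmn : m + 1 ≤ n) : ContDiffOn ℝ m (pdy f) D :=
  (hf.fderiv_of_isOpen hD hmn).clm_apply contDiffOn_const

theorem Set.EqOn.pdx {D : Set (ℝ × ℝ)} (hD : IsOpen D) {f g : ℝ × ℝ → ℝ} (h : EqOn f g D) :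
    EqOn (pdx f) (pdx g) D := fun p hp => by
  simp only [_root_.pdx, (h.eventuallyEq_of_mem (hD.mem_nhds hp)).fderiv_eq]

theorem Set.EqOn.pdy {D : Set (ℝ × ℝ)} (hD : IsOpen D) {f g : ℝ × ℝ → ℝ} (h : EqOn f g D) :
    EqOn (pdy f) (pdy g) D := fun p hp => by
  simp only [_root_.pdy, (h.eventuallyEq_of_mem (hD.mem_nhds hp)).fderiv_eq]

theorem pdx_const_mul_add_const_mul {f g : ℝ × ℝ → ℝ} {p : ℝ × ℝ} (hf : DifferentiableAt ℝ f p)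
    (hg : DifferentiableAt ℝ g p) (α β : ℝ) :
    pdx (fun q => α * f q + β * g q) p = α * pdx f p + β * pdx g p := by
  simp [pdx, fderiv_fun_add (hf.const_mul α) (hg.const_mul β), fderiv_const_mul hf,
    fderiv_const_mul hg]

theorem pdy_const_mul_add_const_mul {f g : ℝ × ℝ → ℝ} {p : ℝ × ℝ} (hf : DifferentiableAt ℝ f p)
    (hg : DifferentiableAt ℝ g p) (α β : ℝ) :
    pdy (fun q => α * f q + β * g q) p = α * pdy f p + β * pdy g p := by
  simp [pdy, fderiv_fun_add (hf.const_mul α) (hg.const_mul β), fderiv_const_mul hf,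
    fderiv_const_mul hg]

/-- Mixed partial derivatives of a `C²` function commute. -/
theorem pdx_pdy_eqOn {D : Set (ℝ × ℝ)} (hD : IsOpen D) {f : ℝ × ℝ → ℝ}
    (hf : ContDiffOn ℝ 2 f D) : EqOn (pdx (pdy f)) (pdy (pdx f)) D := fun p hp => by
  have hd : DifferentiableAt ℝ (fderiv ℝ f) p :=
    ((hf.fderiv_of_isOpen hD (m := 1) (by norm_num)).differentiableOn
      one_ne_zero).differentiableAt (hD.mem_nhds hp)
  have hs := (hf.contDiffAt (hD.mem_nhds hp)).isSymmSndFDerivAt (by simp)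
  have happ : ∀ v w : ℝ × ℝ, fderiv ℝ (fun q => fderiv ℝ f q v) p w =
      fderiv ℝ (fderiv ℝ f) p w v := fun v w => by
    rw [fderiv_clm_apply hd (differentiableAt_const v)]
    simp
  change fderiv ℝ (fun q => fderiv ℝ f q (0, 1)) p (1, 0) =
    fderiv ℝ (fun q => fderiv ℝ f q (1, 0)) p (0, 1)
  rw [happ, happ]
  exact hs _ _

/-- A closed form `P dx + Q dy` on a simply connected open subset of the plane is exact. -/
theorem exists_pdx_eq_pdy_eq {D : Set (ℝ × ℝ)} (hsc : IsSimplyConnected D) (hD : IsOpen D)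
    {P Q : ℝ × ℝ → ℝ} (hP : DifferentiableOn ℝ P D) (hQ : DifferentiableOn ℝ Q D)
    (h : ∀ p ∈ D, pdy P p = pdx Q p) :
    ∃ f : ℝ × ℝ → ℝ, DifferentiableOn ℝ f D ∧ EqOn (pdx f) P D ∧ EqOn (pdy f) Q D := by
  set u := ContinuousLinearMap.fst ℝ ℝ ℝ
  set v := ContinuousLinearMap.snd ℝ ℝ ℝ
  have hω : ∀ p ∈ D, HasFDerivAt (fun q => P q • u + Q q • v)
      ((fderiv ℝ P p).smulRight u + (fderiv ℝ Q p).smulRight v) p := fun p hp =>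
    ((hP.differentiableAt (hD.mem_nhds hp)).hasFDerivAt.smul_const u).add
      ((hQ.differentiableAt (hD.mem_nhds hp)).hasFDerivAt.smul_const v)
  obtain ⟨f, hf⟩ := hsc.exists_forall_hasFDerivAt_of_fderiv_symmetric hD
    (fun p hp => (hω p hp).differentiableAt.differentiableWithinAt) (fun p hp x y => by
      have key : ∀ L : ℝ × ℝ →L[ℝ] ℝ, ∀ z : ℝ × ℝ, L z = z.1 * L (1, 0) + z.2 * L (0, 1) :=
        fun L z => by
          conv_lhs => rw [show z = z.1 • ((1, 0) : ℝ × ℝ) + z.2 • ((0, 1) : ℝ × ℝ) by ext <;> simp]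
          simp only [map_add, map_smul, smul_eq_mul]
      have hpq : fderiv ℝ P p (0, 1) = fderiv ℝ Q p (1, 0) := h p hp
      rw [(hω p hp).fderiv]
      simp only [u, v, add_apply, ContinuousLinearMap.smulRight_apply,
        smul_apply, ContinuousLinearMap.coe_fst', ContinuousLinearMap.coe_snd',
        smul_eq_mul]
      rw [key (fderiv ℝ P p) x, key (fderiv ℝ P p) y, key (fderiv ℝ Q p) x, key (fderiv ℝ Q p) y,
        hpq]
      ring)
  refine ⟨f, fun p hp => (hf p hp).differentiableAt.differentiableWithinAt,
    fun p hp => ?_, fun p hp => ?_⟩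
  · simp [pdx, (hf p hp).fderiv, u, v]
  · simp [pdy, (hf p hp).fderiv, u, v]

/-- Every biharmonic function `W` on a bounded simply connected open set `D ⊆ ℝ²`
is the first component of a monogenic function: there exist differentiable
`U₂, U₃, U₄` such that `(W, U₂, U₃, U₄)` satisfies the Cauchy–Riemann-type
system on `D`. -/
theorem biharmonic_is_first_component (D : Set (ℝ × ℝ)) (hD : IsOpen D)
    (hbd : Bornology.IsBounded D) (hsc : SimplyConnectedSpace D)
    (W : ℝ × ℝ → ℝ) (hW : ContDiffOn ℝ 4 W D)
    (hbih : ∀ p ∈ D, pdx (pdx (pdx (pdx W))) p + 2 * pdx (pdx (pdy (pdy W))) p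
      + pdy (pdy (pdy (pdy W))) p = 0) :
    ∃ U₂ U₃ U₄ : ℝ × ℝ → ℝ,
      (∀ p ∈ D, DifferentiableAt ℝ U₂ p ∧ DifferentiableAt ℝ U₃ p ∧
        DifferentiableAt ℝ U₄ p) ∧
      ∀ p ∈ D, CRsys W U₂ U₃ U₄ p := by
  have hsc' : IsSimplyConnected D := hsc
  have hx : ContDiffOn ℝ 3 (pdx W) D := hW.pdx hD (by norm_num)
  have hy : ContDiffOn ℝ 3 (pdy W) D := hW.pdy hD (by norm_num)
  have hxx : ContDiffOn ℝ 2 (pdx (pdx W)) D := hx.pdx hD (by norm_num)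
  have hyy : ContDiffOn ℝ 2 (pdy (pdy W)) D := hy.pdy hD (by norm_num)
  have diff : ∀ {n : WithTop ℕ∞} {f : ℝ × ℝ → ℝ}, ContDiffOn ℝ n f D → n ≠ 0 →
      ∀ p ∈ D, DifferentiableAt ℝ f p := fun hf hn p hp =>
    (hf.differentiableOn hn).differentiableAt (hD.mem_nhds hp)
  have diff' : ∀ {f : ℝ × ℝ → ℝ}, DifferentiableOn ℝ f D → ∀ p ∈ D, DifferentiableAt ℝ f p :=
    fun hf p hp => hf.differentiableAt (hD.mem_nhds hp)
  have lin : ∀ {f g : ℝ × ℝ → ℝ} (α β : ℝ), (∀ p ∈ D, DifferentiableAt ℝ f p) →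
      (∀ p ∈ D, DifferentiableAt ℝ g p) →
      DifferentiableOn ℝ (fun q => α * f q + β * g q) D := fun α β hf hg p hp =>
    (((hf p hp).const_mul α).add ((hg p hp).const_mul β)).differentiableWithinAt
  have dx := diff hx (by norm_num)
  have dy := diff hy (by norm_num)
  have dxx := diff hxx (by norm_num)
  have dyy := diff hyy (by norm_num)
  have dxxx := diff (hxx.pdx hD (m := 1) (by norm_num)) (by norm_num)
  have dxxy := diff (hxx.pdy hD (m := 1) (by norm_num)) (by norm_num)
  have dyyx := diff (hyy.pdx hD (m := 1) (by norm_num)) (by norm_num)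
  have dyyy := diff (hyy.pdy hD (m := 1) (by norm_num)) (by norm_num)
  have hmix : EqOn (pdy (pdy (pdx (pdx W)))) (pdx (pdx (pdy (pdy W)))) D := by
    have h₁ : EqOn (pdy (pdx (pdx W))) (pdx (pdx (pdy W))) D := fun p hp => by
      rw [← pdx_pdy_eqOn hD (hx.of_le (by norm_num)) hp]
      exact ((pdx_pdy_eqOn hD (hW.of_le (by norm_num))).symm.pdx hD) hp
    have h₂ : EqOn (pdy (pdx (pdx (pdy W)))) (pdx (pdx (pdy (pdy W)))) D := fun p hp => by
      rw [← pdx_pdy_eqOn hD (hy.pdx hD (by norm_num)) hp]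
      exact ((pdx_pdy_eqOn hD (hy.of_le (by norm_num))).symm.pdx hD) hp
    exact (h₁.pdy hD).trans h₂
  -- `b` is the mixed derivative of `U₄`, and `s`, `t` are its first derivatives.
  obtain ⟨b, hb, hbx, hby⟩ := exists_pdx_eq_pdy_eq hsc' hD
    (lin (1 / 2) (-1 / 2) dxxy dyyy) (lin (1 / 2) (3 / 2) dxxx dyyx) fun p hp => by
      rw [pdy_const_mul_add_const_mul (dxxy p hp) (dyyy p hp),
        pdx_const_mul_add_const_mul (dxxx p hp) (dyyx p hp), hmix hp]
      linarith [hbih p hp]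
  obtain ⟨s, hs, hsx, hsy⟩ := exists_pdx_eq_pdy_eq hsc' hD
    (lin (1 / 2) (-1 / 2) dxx dyy) hb fun p hp => by
      rw [pdy_const_mul_add_const_mul (dxx p hp) (dyy p hp), hbx hp]
  obtain ⟨t, ht, htx, hty⟩ := exists_pdx_eq_pdy_eq hsc' hD
    hb (lin (1 / 2) (3 / 2) dxx dyy) fun p hp => by
      rw [pdx_const_mul_add_const_mul (dxx p hp) (dyy p hp), hby hp]
  obtain ⟨U₄, h₄, h₄x, h₄y⟩ := exists_pdx_eq_pdy_eq hsc' hD hs ht fun p hp => by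
    rw [hsy hp, htx hp]
  obtain ⟨U₃, h₃, h₃x, h₃y⟩ := exists_pdx_eq_pdy_eq hsc' hD
    (hy.differentiableOn (by norm_num)) (lin 1 (-2) dx (diff' hs)) fun p hp => by
      rw [pdx_const_mul_add_const_mul (dx p hp) (diff' hs p hp), hsx hp]
      ring
  obtain ⟨U₂, h₂, h₂x, h₂y⟩ := exists_pdx_eq_pdy_eq hsc' hD
    (lin 1 (-2) (diff' ht) dy) hs fun p hp => by
      rw [pdy_const_mul_add_const_mul (diff' ht p hp) (dy p hp), hty hp, hsx hp]
      ring
  refine ⟨U₂, U₃, U₄, fun p hp => ⟨diff' h₂ p hp, diff' h₃ p hp, diff' h₄ p hp⟩, fun p hp => ?_⟩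
  simp only [CRsys, h₂x hp, h₂y hp, h₃x hp, h₃y hp, h₄x hp, h₄y hp]
  refine ⟨trivial, trivial, ?_, ?_⟩ <;> ring
end
end

section
/- Theorem 3 (homogeneous (u_x, v_y)-problem): let D ⊂ ℝ² be a bounded open set, let μ > 0 and λ + μ > 0 be Lamé constants, and set κ₀ = (λ+2μ)/(2(λ+μ)). Let W : D → ℝ be four times continuously differentiable with Δ²W = 0 in D, and suppose ∂²W/∂x² and ∂²W/∂y² extend continuously to the closure of D. Define V₁ = (1/(2μ))·(∂²W/∂x² + κ₀·ΔW) and V₂ = (1/(2μ))·(∂²W/∂y² + κ₀·ΔW). If the boundary limits of V₁ and V₂ vanish at every point of ∂D, then V₁(x,y) = 0 and V₂(x,y) = 0 for all (x,y) ∈ D. -/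
/- Theorem 3: the homogeneous (u_x, v_y)-problem has only the trivial solution.
   Here W is the Airy stress function, V₁ = ∂u/∂x, V₂ = ∂v/∂y are given by
   2μV₁ = W_xx + κ₀ΔW, 2μV₂ = W_yy + κ₀ΔW with κ₀ = (λ+2μ)/(2(λ+μ)). -/

open Filter Topology

noncomputable section

/-- The derivative of `f` in the direction `v`. -/
def dirDeriv (v : ℝ × ℝ) (f : ℝ × ℝ → ℝ) : ℝ × ℝ → ℝ := fun p => fderiv ℝ f p v

theorem pdx_eq_dirDeriv : pdx = dirDeriv (1, 0) := rfl

theorem pdy_eq_dirDeriv : pdy = dirDeriv (0, 1) := rfl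

section DirDeriv

variable {D : Set (ℝ × ℝ)} {f g : ℝ × ℝ → ℝ}

theorem ContDiffOn.dirDeriv {m n : WithTop ℕ∞} (hf : ContDiffOn ℝ n f D) (hD : IsOpen D)
    (hmn : m + 1 ≤ n) (v : ℝ × ℝ) : ContDiffOn ℝ m (dirDeriv v f) D :=
  (hf.fderiv_of_isOpen hD hmn).clm_apply contDiffOn_const

theorem Set.EqOn.dirDeriv (h : Set.EqOn f g D) (hD : IsOpen D) (v : ℝ × ℝ) :
    Set.EqOn (dirDeriv v f) (dirDeriv v g) D := fun p hp => by
  have : f =ᶠ[𝓝 p] g := h.eventuallyEq_of_mem (hD.mem_nhds hp)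
  simp only [_root_.dirDeriv, this.fderiv_eq]

theorem dirDeriv_comm (hf : ContDiffOn ℝ 2 f D) (hD : IsOpen D) (u v : ℝ × ℝ) :
    Set.EqOn (dirDeriv u (dirDeriv v f)) (dirDeriv v (dirDeriv u f)) D := fun p hp => by
  have hp' := hD.mem_nhds hp
  have hs : IsSymmSndFDerivAt ℝ f p :=
    (hf.contDiffAt hp').isSymmSndFDerivAt (by simp)
  have hd : DifferentiableAt ℝ (fderiv ℝ f) p :=
    ((hf.fderiv_of_isOpen hD (m := 1) (by norm_num)).differentiableOn
      (by norm_num)).differentiableAt hp'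
  have key (a b : ℝ × ℝ) : dirDeriv a (dirDeriv b f) p = fderiv ℝ (fderiv ℝ f) p a b := by
    unfold dirDeriv
    rw [fderiv_clm_apply hd (differentiableAt_const b)]
    simp
  rw [key, key, hs.eq]

theorem dirDeriv_add (hf : DifferentiableOn ℝ f D) (hg : DifferentiableOn ℝ g D)
    (hD : IsOpen D) (v : ℝ × ℝ) :
    Set.EqOn (dirDeriv v (f + g)) (dirDeriv v f + dirDeriv v g) D := fun p hp => by
  have hp' := hD.mem_nhds hp
  simp [dirDeriv, fderiv_add (hf.differentiableAt hp') (hg.differentiableAt hp')]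

theorem dirDeriv_dirDeriv_add (hf : ContDiffOn ℝ 2 f D) (hg : ContDiffOn ℝ 2 g D)
    (hD : IsOpen D) (u v : ℝ × ℝ) :
    Set.EqOn (dirDeriv u (dirDeriv v (f + g)))
      (dirDeriv u (dirDeriv v f) + dirDeriv u (dirDeriv v g)) D := by
  have h12 : (1 : WithTop ℕ∞) + 1 ≤ 2 := by norm_num
  exact ((dirDeriv_add (hf.differentiableOn (by norm_num)) (hg.differentiableOn (by norm_num))
    hD v).dirDeriv hD u).trans <| dirDeriv_add
      ((hf.dirDeriv hD h12 v).differentiableOn (by norm_num))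
      ((hg.dirDeriv hD h12 v).differentiableOn (by norm_num)) hD u

theorem dirDeriv_neg (v : ℝ × ℝ) (f : ℝ × ℝ → ℝ) : dirDeriv v (-f) = -dirDeriv v f := by
  ext p
  simp [dirDeriv, fderiv_neg]

theorem dirDeriv_const_mul_fst_sq (ε : ℝ) (v : ℝ × ℝ) :
    dirDeriv v (fun p => ε * p.1 ^ 2) = fun p => 2 * ε * v.1 * p.1 := by
  ext p
  have h : HasFDerivAt (fun p : ℝ × ℝ => ε * p.1 ^ 2) _ p :=
    ((hasFDerivAt_fst (𝕜 := ℝ) (E := ℝ) (F := ℝ) (p := p)).pow 2).const_mul ε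
  rw [dirDeriv, h.fderiv]
  simp
  ring

theorem dirDeriv_const_mul_fst (c : ℝ) (v : ℝ × ℝ) :
    dirDeriv v (fun p => c * p.1) = fun _ => c * v.1 := by
  ext p
  have h : HasFDerivAt (fun p : ℝ × ℝ => c * p.1) _ p :=
    (hasFDerivAt_fst (𝕜 := ℝ) (E := ℝ) (F := ℝ) (p := p)).const_mul c
  rw [dirDeriv, h.fderiv]
  simp

end DirDeriv

theorem IsLocalMax.deriv_deriv_nonpos {φ : ℝ → ℝ} {a : ℝ} (h : IsLocalMax φ a)
    (hc : ContinuousAt φ a) : deriv (deriv φ) a ≤ 0 := by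
  by_contra! hpos
  have hmin := isLocalMin_of_deriv_deriv_pos hpos h.deriv_eq_zero hc
  have hconst : φ =ᶠ[𝓝 a] fun _ => φ a := by
    filter_upwards [h, hmin] with x h₁ h₂ using le_antisymm h₁ h₂
  exact hpos.ne' (by simpa using hconst.deriv.deriv_eq)

theorem IsLocalMax.dirDeriv_dirDeriv_nonpos {f : ℝ × ℝ → ℝ} {q : ℝ × ℝ} (h : IsLocalMax f q)
    (hf : ContDiffAt ℝ 2 f q) (v : ℝ × ℝ) : dirDeriv v (dirDeriv v f) q ≤ 0 := by
  have hline (t : ℝ) : HasDerivAt (fun t : ℝ => q + t • v) v t := by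
    simpa using ((hasDerivAt_id t).smul_const v).const_add q
  have hl0 : q + (0 : ℝ) • v = q := by simp
  have hlc : Tendsto (fun t : ℝ => q + t • v) (𝓝 0) (𝓝 q) := by
    simpa using (hline 0).continuousAt.tendsto
  have hder : deriv (fun t : ℝ => f (q + t • v)) =ᶠ[𝓝 0] fun t => dirDeriv v f (q + t • v) := by
    filter_upwards [hlc.eventually (hf.eventually (by simp))] with t ht
    exact ((ht.differentiableAt (by norm_num)).hasFDerivAt.comp_hasDerivAt t (hline t)).deriv
  have hd : DifferentiableAt ℝ (dirDeriv v f) (q + (0 : ℝ) • v) := by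
    rw [hl0]
    exact ((hf.fderiv_right (m := 1) (by norm_num)).clm_apply
      contDiffAt_const).differentiableAt (by norm_num)
  have hsnd : deriv (deriv fun t : ℝ => f (q + t • v)) 0 = dirDeriv v (dirDeriv v f) q := by
    have hcomp := (hd.hasFDerivAt.comp_hasDerivAt 0 (hline 0)).deriv
    rw [hl0] at hcomp
    exact hder.deriv_eq.trans hcomp
  rw [← hsnd]
  refine IsLocalMax.deriv_deriv_nonpos ?_ ?_
  · have := hlc.eventually h
    simpa [IsLocalMax, IsMaxFilter] using this
  · have hfc : Tendsto f (𝓝 q) (𝓝 (f q)) := hf.continuousAt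
    simpa [ContinuousAt, Function.comp_def] using hfc.comp hlc

section MaximumPrinciple

variable {D : Set (ℝ × ℝ)} {f : ℝ × ℝ → ℝ}

theorem continuous_indicator_of_tendsto_frontier (hD : IsOpen D) (hf : ContinuousOn f D)
    (hb : ∀ z ∈ frontier D, Tendsto f (𝓝[D] z) (𝓝 0)) : Continuous (D.indicator f) := by
  refine continuous_iff_continuousAt.2 fun z => ?_
  by_cases hz : z ∈ D
  · refine (hf.continuousAt (hD.mem_nhds hz)).congr ?_
    exact ((Set.eqOn_indicator (s := D) (f := f)).eventuallyEq_of_mem (hD.mem_nhds hz)).symm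
  · have h0 : Tendsto f (𝓝[D] z) (𝓝 0) := by
      by_cases hzc : z ∈ closure D
      · exact hb z (by rw [hD.frontier_eq]; exact ⟨hzc, hz⟩)
      · rw [notMem_closure_iff_nhdsWithin_eq_bot.1 hzc]
        exact tendsto_bot
    rw [ContinuousAt, Set.indicator_of_notMem hz, ← nhdsWithin_univ, ← Set.union_compl_self D,
      nhdsWithin_union]
    refine (h0.congr' ?_).sup (tendsto_const_nhds.congr' ?_)
    · filter_upwards [self_mem_nhdsWithin] with w hw using (Set.indicator_of_mem hw f).symm
    · filter_upwards [self_mem_nhdsWithin] with w hw using (Set.indicator_of_notMem hw f).symm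

/-- Weak maximum principle: a subharmonic function on a bounded open set with vanishing boundary
limits is nonpositive. -/
theorem nonpos_of_laplacian_nonneg (hD : IsOpen D) (hbd : Bornology.IsBounded D)
    (hf : ContDiffOn ℝ 2 f D) (hL : ∀ p ∈ D, 0 ≤ pdx (pdx f) p + pdy (pdy f) p)
    (hb : ∀ z ∈ frontier D, Tendsto f (𝓝[D] z) (𝓝 0)) : ∀ p ∈ D, f p ≤ 0 := by
  intro p hp
  by_contra! hpos
  have hK : IsCompact (closure D) := hbd.isCompact_closure
  obtain ⟨M, hM⟩ := hK.bddAbove_image (f := fun z : ℝ × ℝ => z.1 ^ 2) (by fun_prop)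
  have hM' : ∀ z ∈ closure D, z.1 ^ 2 ≤ M := fun z hz => hM ⟨z, hz, rfl⟩
  have hM0 : 0 ≤ M := (sq_nonneg _).trans (hM' p (subset_closure hp))
  set ε := f p / (M + 1) with hε
  have hε0 : 0 < ε := by positivity
  have hεM : ε * M < f p := by
    rw [hε, div_mul_eq_mul_div, div_lt_iff₀ (by positivity)]
    nlinarith
  set s : ℝ × ℝ → ℝ := fun z => ε * z.1 ^ 2 with hs
  have hsc : ContDiff ℝ 2 s := by fun_prop
  obtain ⟨q, hq, hmax⟩ := hK.exists_isMaxOn ⟨p, subset_closure hp⟩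
    ((continuous_indicator_of_tendsto_frontier hD hf.continuousOn hb).add
      hsc.continuous).continuousOn
  have hpq : D.indicator f p + s p ≤ D.indicator f q + s q := hmax (subset_closure hp)
  rw [Set.indicator_of_mem hp] at hpq
  have hqD : q ∈ D := by
    by_contra hqD
    rw [Set.indicator_of_notMem hqD] at hpq
    have : ε * q.1 ^ 2 ≤ ε * M := mul_le_mul_of_nonneg_left (hM' q hq) hε0.le
    have : 0 ≤ s p := by positivity
    simp only [hs] at *
    linarith
  have hloc : IsLocalMax (f + s) q := by
    filter_upwards [hD.mem_nhds hqD] with z hz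
    simpa [Set.indicator_of_mem hz, Set.indicator_of_mem hqD] using hmax (subset_closure hz)
  have hcd : ContDiffAt ℝ 2 (f + s) q := (hf.contDiffAt (hD.mem_nhds hqD)).add hsc.contDiffAt
  have h₁ := hloc.dirDeriv_dirDeriv_nonpos hcd (1, 0)
  have h₂ := hloc.dirDeriv_dirDeriv_nonpos hcd (0, 1)
  rw [dirDeriv_dirDeriv_add hf hsc.contDiffOn hD _ _ hqD] at h₁ h₂
  simp only [Pi.add_apply, hs, dirDeriv_const_mul_fst_sq, dirDeriv_const_mul_fst] at h₁ h₂
  have := hL q hqD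
  rw [pdx_eq_dirDeriv, pdy_eq_dirDeriv] at this
  linarith

theorem eq_zero_of_laplacian_eq_zero (hD : IsOpen D) (hbd : Bornology.IsBounded D)
    (hf : ContDiffOn ℝ 2 f D) (hL : ∀ p ∈ D, pdx (pdx f) p + pdy (pdy f) p = 0)
    (hb : ∀ z ∈ frontier D, Tendsto f (𝓝[D] z) (𝓝 0)) : ∀ p ∈ D, f p = 0 := by
  intro p hp
  refine le_antisymm (nonpos_of_laplacian_nonneg hD hbd hf (fun q hq => (hL q hq).ge) hb p hp) ?_
  have := nonpos_of_laplacian_nonneg (f := -f) hD hbd hf.neg (fun q hq => ?_)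
    (fun z hz => by simpa [Pi.neg_def] using (hb z hz).neg) p hp
  · simpa using this
  · have := hL q hq
    simp only [pdx_eq_dirDeriv, pdy_eq_dirDeriv, dirDeriv_neg, Pi.neg_apply] at this ⊢
    linarith

end MaximumPrinciple

theorem pdy_pdy_pdx_pdx {D : Set (ℝ × ℝ)} {W : ℝ × ℝ → ℝ} (hW : ContDiffOn ℝ 4 W D)
    (hD : IsOpen D) :
    Set.EqOn (pdy (pdy (pdx (pdx W)))) (pdx (pdx (pdy (pdy W)))) D := by
  have h3 (v : ℝ × ℝ) : ContDiffOn ℝ 3 (dirDeriv v W) D := hW.dirDeriv hD (by norm_num) v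
  have h2 (u v : ℝ × ℝ) : ContDiffOn ℝ 2 (dirDeriv u (dirDeriv v W)) D :=
    (h3 v).dirDeriv hD (by norm_num) u
  simp only [pdx_eq_dirDeriv, pdy_eq_dirDeriv]
  intro p hp
  calc _ = dirDeriv (0, 1) (dirDeriv (1, 0) (dirDeriv (0, 1) (dirDeriv (1, 0) W))) p :=
        (dirDeriv_comm ((h3 _).of_le (by norm_num)) hD _ _).dirDeriv hD _ hp
    _ = dirDeriv (1, 0) (dirDeriv (0, 1) (dirDeriv (0, 1) (dirDeriv (1, 0) W))) p :=
        dirDeriv_comm (h2 _ _) hD _ _ hp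
    _ = dirDeriv (1, 0) (dirDeriv (0, 1) (dirDeriv (1, 0) (dirDeriv (0, 1) W))) p :=
        ((dirDeriv_comm (hW.of_le (by norm_num)) hD _ _).dirDeriv hD _).dirDeriv hD _ hp
    _ = _ := (dirDeriv_comm ((h3 _).of_le (by norm_num)) hD _ _).dirDeriv hD _ hp

/-- Homogeneous `(u_x, v_y)`-problem: with Lamé constants `μ > 0`, `λ + μ > 0`,
`κ₀ = (λ+2μ)/(2(λ+μ))`, a biharmonic Airy function `W` whose second derivatives
extend continuously to the closure of the bounded open set `D`, and displacement
derivatives `V₁ = (1/(2μ))·(W_xx + κ₀·ΔW)`, `V₂ = (1/(2μ))·(W_yy + κ₀·ΔW)`: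
if the boundary limits of `V₁` and `V₂` vanish at every point of `∂D`, then
`V₁ = V₂ = 0` in `D`. -/
theorem homogeneous_ux_vy_problem (D : Set (ℝ × ℝ)) (hD : IsOpen D)
    (hbd : Bornology.IsBounded D)
    (lam μ : ℝ) (hμ : 0 < μ) (hlm : 0 < lam + μ)
    (κ₀ : ℝ) (hκ₀ : κ₀ = (lam + 2 * μ) / (2 * (lam + μ)))
    (W : ℝ × ℝ → ℝ) (hW : ContDiffOn ℝ 4 W D)
    (hbih : ∀ p ∈ D, pdx (pdx (pdx (pdx W))) p + 2 * pdx (pdx (pdy (pdy W))) p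
      + pdy (pdy (pdy (pdy W))) p = 0)
    (hextx : ∀ z ∈ frontier D, ∃ L : ℝ, Tendsto (pdx (pdx W)) (𝓝[D] z) (𝓝 L))
    (hexty : ∀ z ∈ frontier D, ∃ L : ℝ, Tendsto (pdy (pdy W)) (𝓝[D] z) (𝓝 L))
    (V₁ V₂ : ℝ × ℝ → ℝ)
    (hV₁ : V₁ = fun p => (1 / (2 * μ)) *
      (pdx (pdx W) p + κ₀ * (pdx (pdx W) p + pdy (pdy W) p)))
    (hV₂ : V₂ = fun p => (1 / (2 * μ)) *
      (pdy (pdy W) p + κ₀ * (pdx (pdx W) p + pdy (pdy W) p)))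
    (hb₁ : ∀ z ∈ frontier D, Tendsto V₁ (𝓝[D] z) (𝓝 0))
    (hb₂ : ∀ z ∈ frontier D, Tendsto V₂ (𝓝[D] z) (𝓝 0)) :
    ∀ p ∈ D, V₁ p = 0 ∧ V₂ p = 0 := by
  have hxx : ContDiffOn ℝ 2 (pdx (pdx W)) D :=
    (hW.dirDeriv (m := 3) hD (by norm_num) _).dirDeriv hD (by norm_num) _
  have hyy : ContDiffOn ℝ 2 (pdy (pdy W)) D :=
    (hW.dirDeriv (m := 3) hD (by norm_num) _).dirDeriv hD (by norm_num) _
  have hcomm := pdy_pdy_pdx_pdx hW hD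
  have hκ : 0 < 1 + 2 * κ₀ := by
    have : 0 < κ₀ := by rw [hκ₀]; apply div_pos <;> linarith
    linarith
  have hlap : ∀ p ∈ D, (pdx (pdx W) + pdy (pdy W)) p = 0 := by
    refine eq_zero_of_laplacian_eq_zero hD hbd (hxx.add hyy) (fun p hp => ?_) fun z hz => ?_
    · have h₁ := dirDeriv_dirDeriv_add hxx hyy hD (1, 0) (1, 0) hp
      have h₂ := dirDeriv_dirDeriv_add hxx hyy hD (0, 1) (0, 1) hp
      simp only [Pi.add_apply, ← pdx_eq_dirDeriv, ← pdy_eq_dirDeriv] at h₁ h₂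
      rw [h₁, h₂, hcomm hp]
      linarith [hbih p hp]
    · have := ((hb₁ z hz).add (hb₂ z hz)).const_mul (2 * μ / (1 + 2 * κ₀))
      rw [add_zero, mul_zero] at this
      refine this.congr fun p => ?_
      simp only [hV₁, hV₂, Pi.add_apply]
      field_simp
      ring
  have hlap_xx : ∀ p ∈ D, pdx (pdx (pdx (pdx W))) p + pdx (pdx (pdy (pdy W))) p = 0 := by
    intro p hp
    have h₁ := dirDeriv_dirDeriv_add hxx hyy hD (1, 0) (1, 0) hp
    have h₂ : Set.EqOn (pdx (pdx W) + pdy (pdy W)) (fun q => 0 * q.1) D :=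
      fun q hq => by simpa using hlap q hq
    rw [(h₂.dirDeriv hD (1, 0)).dirDeriv hD (1, 0) hp, dirDeriv_const_mul_fst, ← pdx_eq_dirDeriv] at h₁
    simpa [pdx] using h₁.symm
  have hWxx : ∀ p ∈ D, pdx (pdx W) p = 0 := by
    refine eq_zero_of_laplacian_eq_zero hD hbd hxx (fun p hp => ?_) fun z hz => ?_
    · rw [hcomm hp, hlap_xx p hp]
    · have := (hb₁ z hz).const_mul (2 * μ)
      rw [mul_zero] at this
      refine this.congr' ?_
      filter_upwards [self_mem_nhdsWithin] with p hp
      have := hlap p hp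
      rw [Pi.add_apply] at this
      simp only [hV₁, this]
      field_simp
      ring
  intro p hp
  have h₁ := hWxx p hp
  have h₂ : pdy (pdy W) p = 0 := by simpa [h₁] using hlap p hp
  simp [hV₁, hV₂, h₁, h₂]
end
end
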